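/- Let T be an elementary abelian 2-subgroup of an abelian group G of rank 2m+1, let t ∈ T be an order-2 element, and let T₁, T₂ be two index-2 subgroups of T not containing t. Let τ₁: T₁ → F and τ₂: T₂ → F be quadratic forms whose polar forms β₁: T₁×T₁ → F and β₂: T₂×T₂ → F are nondegenerate alternating bicharacters, and suppose τ₁^{[t]} = τ₂^{[t]}. Then D_inv(T₁,β₁,τ₁)^ex_t ≅ D_inv(T₂,β₂,τ₂)^ex_t as G-graded algebras with involution, where F is an algebraically closed field of characteristic different from 2. -/

import Mathlib

universe u v w

section defs

variable (F : Type u) [Field F] (G : Type v) [CommGroup G]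

/-- The exchange involution `(x,y) ↦ (y,x)` on `D ⊕ D^op`. -/
def exInvG (D : Type w) [Ring D] [Algebra F D] : (D × Dᵐᵒᵖ) →ₗ[F] (D × Dᵐᵒᵖ) :=
  (((MulOpposite.opLinearEquiv F).symm.toLinearMap).comp (LinearMap.snd F D Dᵐᵒᵖ)).prod
    (((MulOpposite.opLinearEquiv F).toLinearMap).comp (LinearMap.fst F D Dᵐᵒᵖ))

/-- The exchange grading `Γ^ex_t` on `D ⊕ D^op` twisted by an order 2 element `t`:
for `x ∈ D_h`, `(x, φ(x))` has degree `h` and `(x, −φ(x))` has degree `ht`; thus the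
homogeneous component of degree `h` is `{(x+y, op (φ₀ x − φ₀ y)) : x ∈ D_h, y ∈ D_{ht}}`. -/
def exGrT {D : Type w} [Ring D] [Algebra F D] (φ₀ : D →ₗ[F] D) (Dgr : G → Submodule F D)
    (t : G) (h : G) : Submodule F (D × Dᵐᵒᵖ) :=
  Submodule.map
    ((LinearMap.fst F D D + LinearMap.snd F D D).prod
      ((MulOpposite.opLinearEquiv F).toLinearMap.comp
        (φ₀.comp (LinearMap.fst F D D) - φ₀.comp (LinearMap.snd F D D))))
    ((Dgr h).prod (Dgr (h * t)))

/-- The projection of `T'⟨t⟩` onto `T'` along `t`. -/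
noncomputable def projT (T' : Subgroup G) (t s : G) : G :=
  @ite _ (s ∈ T') (Classical.dec _) s (s * t)

/-- `τ^[t]` : `τ^[t](u t^k) = τ(u)·(−1)^k` for `u ∈ T'`, `k ∈ {0,1}`. -/
noncomputable def tauExt (T' : Subgroup G) (t : G) (τ : G → F) (s : G) : F :=
  @ite _ (s ∈ T') (Classical.dec _) (τ s) (-(τ (s * t)))

/-- `β^[t]` : `β^[t](u t^{k₁}, v t^{k₂}) = β(u,v)` for `u,v ∈ T'`. -/
noncomputable def betaExt (T' : Subgroup G) (t : G) (β : G → G → F) (s s' : G) : F :=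
  β (projT G T' t s) (projT G T' t s')

/-- `τ` is a quadratic form on `T` with values in `{±1}` whose polar form `β` is a
nondegenerate alternating bicharacter on `T`. -/
def QuadData (T : Subgroup G) (β : G → G → F) (τ : G → F) : Prop :=
  (∀ u ∈ T, τ u = 1 ∨ τ u = -1) ∧
  (∀ u ∈ T, ∀ v ∈ T, β u v = τ (u * v) * τ u * τ v) ∧
  (∀ u ∈ T, ∀ v ∈ T, ∀ w ∈ T, β (u * v) w = β u w * β v w) ∧
  (∀ u ∈ T, ∀ v ∈ T, ∀ w ∈ T, β u (v * w) = β u v * β u w) ∧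
  (∀ u ∈ T, β u u = 1) ∧
  (∀ u ∈ T, (∀ v ∈ T, β u v = 1) → u = 1)

/-- `(D, φ₀, Dgr, X)` is (a realization of) `D_inv(T,β,τ)`: the standard realization
`D(T,β)` — a `G`-graded division algebra with support `T`, one-dimensional components spanned
by the `X t` with commutation relations given by `β` — equipped with the involution
`d ↦ τ(s)·d` for `d` of degree `s`. -/
def IsDinv [DecidableEq G] (D : Type w) [Ring D] [Algebra F D] (φ₀ : D →ₗ[F] D)
    (Dgr : G → Submodule F D) (X : G → D) (T : Subgroup G) (β : G → G → F) (τ : G → F) :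
    Prop :=
  DirectSum.IsInternal Dgr ∧ (1 : D) ∈ Dgr 1 ∧
  (∀ g h : G, ∀ x ∈ Dgr g, ∀ y ∈ Dgr h, x * y ∈ Dgr (g * h)) ∧
  FiniteDimensional F D ∧
  (∀ g : G, ∀ x ∈ Dgr g, x ≠ 0 → IsUnit x) ∧
  (∀ g : G, Dgr g ≠ ⊥ ↔ g ∈ T) ∧
  (∀ t' ∈ T, X t' ≠ 0 ∧ X t' ∈ Dgr t' ∧ ∀ x ∈ Dgr t', ∃ c : F, x = c • X t') ∧
  (∀ t₁ ∈ T, ∀ t₂ ∈ T, X t₁ * X t₂ = β t₁ t₂ • (X t₂ * X t₁)) ∧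
  (∀ a, φ₀ (φ₀ a) = a) ∧ (∀ a b, φ₀ (a * b) = φ₀ b * φ₀ a) ∧
  (∀ t' ∈ T, ∀ x ∈ Dgr t', φ₀ x = τ t' • x)

end defs

section Cocycle

variable {A M : Type*} [CommGroup A] [CommGroup M]

/-- The underlying set `M × A` of the abelian extension of `A` by `M` attached to a symmetric
2-cocycle `r`. -/
@[ext]
structure CocycleExt (r : A → A → M) where
  fst : M
  snd : A

namespace CocycleExt

variable {r : A → A → M}

theorem cocycle_one_left (hr : ∀ a b c, r a b * r (a * b) c = r b c * r a (b * c)) (a : A) :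
    r 1 a = r 1 1 := by
  simpa using (hr 1 1 a).symm

/-- The abelian group structure on `CocycleExt r`. -/
abbrev commGroup (hs : ∀ a b, r a b = r b a)
    (hr : ∀ a b c, r a b * r (a * b) c = r b c * r a (b * c)) : CommGroup (CocycleExt r) :=
  letI : Mul (CocycleExt r) := ⟨fun x y => ⟨x.1 * y.1 * r x.2 y.2, x.2 * y.2⟩⟩
  letI : One (CocycleExt r) := ⟨⟨(r 1 1)⁻¹, 1⟩⟩
  letI : Inv (CocycleExt r) := ⟨fun x => ⟨x.1⁻¹ * (r x.2⁻¹ x.2)⁻¹ * (r 1 1)⁻¹, x.2⁻¹⟩⟩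
  { Group.ofLeftAxioms
      (fun x y z : CocycleExt r => CocycleExt.ext
        (show x.1 * y.1 * r x.2 y.2 * z.1 * r (x.2 * y.2) z.2
            = x.1 * (y.1 * z.1 * r y.2 z.2) * r x.2 (y.2 * z.2) by
          have := hr x.2 y.2 z.2
          calc _ = x.1 * y.1 * z.1 * (r x.2 y.2 * r (x.2 * y.2) z.2) := by ac_rfl
            _ = _ := by rw [this]; ac_rfl)
        (mul_assoc x.2 y.2 z.2))
      (fun x : CocycleExt r => CocycleExt.ext
        (show (r 1 1)⁻¹ * x.1 * r 1 x.2 = x.1 by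
          rw [cocycle_one_left hr x.2, mul_comm, mul_inv_cancel_left])
        (one_mul x.2))
      (fun x : CocycleExt r => CocycleExt.ext
        (show x.1⁻¹ * (r x.2⁻¹ x.2)⁻¹ * (r 1 1)⁻¹ * x.1 * r x.2⁻¹ x.2 = (r 1 1)⁻¹ by
          rw [mul_right_comm _ x.1, mul_comm]
          simp [mul_assoc])
        (inv_mul_cancel x.2)) with
    mul_comm := fun x y => CocycleExt.ext
      (show x.1 * y.1 * r x.2 y.2 = y.1 * x.1 * r y.2 x.2 by
        rw [hs, mul_comm x.1])
      (mul_comm x.2 y.2) }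

end CocycleExt

/-- A symmetric 2-cocycle on an abelian group with values in a divisible group is a coboundary. -/
theorem exists_coboundary_of_symm_cocycle (hM : Module.Baer ℤ (Additive M)) (r : A → A → M)
    (hs : ∀ a b, r a b = r b a) (hr : ∀ a b c, r a b * r (a * b) c = r b c * r a (b * c)) :
    ∃ f : A → M, ∀ a b, r a b * f (a * b) = f a * f b := by
  let := CocycleExt.commGroup hs hr
  have mul_def (x y : CocycleExt r) : x * y = ⟨x.1 * y.1 * r x.2 y.2, x.2 * y.2⟩ := rfl
  let ι : M →* CocycleExt r := MonoidHom.mk' (fun m => ⟨m * (r 1 1)⁻¹, 1⟩) (fun a b => by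
    rw [mul_def]
    refine CocycleExt.ext ?_ (one_mul 1).symm
    change a * b * (r 1 1)⁻¹ = a * (r 1 1)⁻¹ * (b * (r 1 1)⁻¹) * r 1 1
    rw [mul_assoc (a * _), inv_mul_cancel_right, mul_right_comm])
  have hι : Function.Injective ι := fun a b h => mul_right_cancel (congrArg CocycleExt.fst h)
  obtain ⟨χ, hχ⟩ := hM.extension_property_addMonoidHom (MonoidHom.toAdditive ι)
    (fun a b h => hι h) (AddMonoidHom.id _)
  have hχι (m : M) : (χ (Additive.ofMul (ι m))).toMul = m :=
    congrArg Additive.toMul (DFunLike.congr_fun hχ (Additive.ofMul m))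
  refine ⟨fun a => (χ (Additive.ofMul ⟨1, a⟩)).toMul, fun a b => ?_⟩
  have key : (⟨1, a⟩ * ⟨1, b⟩ : CocycleExt r) = ι (r a b) * ⟨1, a * b⟩ := by
    rw [mul_def, mul_def]
    refine CocycleExt.ext ?_ (one_mul _).symm
    change 1 * 1 * r a b = r a b * (r 1 1)⁻¹ * 1 * r 1 (a * b)
    rw [CocycleExt.cocycle_one_left hr (a * b)]
    simp
  have := congrArg (fun x => (χ (Additive.ofMul x)).toMul) key
  simp only [ofMul_mul, map_add, toMul_add, hχι] at this
  exact this.symm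

/-- The multiplicative group of an algebraically closed field is an injective abelian group. -/
theorem IsAlgClosed.baer_units (F : Type*) [Field F] [IsAlgClosed F] :
    Module.Baer ℤ (Additive Fˣ) := by
  let : RootableBy Fˣ ℕ := rootableByOfPowLeftSurj _ _ fun {n} hn a => by
    obtain ⟨z, hz⟩ := IsAlgClosed.exists_pow_nat_eq (a : F) (Nat.pos_of_ne_zero hn)
    have hz0 : z ≠ 0 := fun h => a.ne_zero (by rw [← hz, h, zero_pow hn])
    exact ⟨Units.mk0 z hz0, Units.ext (by simpa using hz)⟩
  let : RootableBy Fˣ ℤ := Group.rootableByIntOfRootableByNat Fˣ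
  let : DivisibleBy (Additive Fˣ) ℤ :=
    { div := fun a n => Additive.ofMul (RootableBy.root a.toMul n)
      div_zero := fun a => congrArg Additive.ofMul (RootableBy.root_zero a.toMul)
      div_cancel := fun a hn => congrArg Additive.ofMul (RootableBy.root_cancel a.toMul hn) }
  exact Module.Baer.of_divisible _

end Cocycle

section TwistedGroupAlgebra

variable {F A D D' : Type*} [Field F] [CommGroup A] [Ring D] [Algebra F D] [Ring D'] [Algebra F D']

/-- The structure constants of a twisted group algebra form a 2-cocycle. -/
theorem twisted_cocycle (b : Module.Basis A F D) (c : A → A → Fˣ)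
    (hc : ∀ u v, b u * b v = (c u v : F) • b (u * v)) (u v w : A) :
    c u v * c (u * v) w = c v w * c u (v * w) := by
  have h := mul_assoc (b u) (b v) (b w)
  rw [hc, hc v w, smul_mul_assoc, mul_smul_comm, hc, hc, smul_smul, smul_smul, mul_assoc u] at h
  exact Units.ext (smul_left_injective F (b.ne_zero _) h)

theorem twisted_comm (b : Module.Basis A F D) (c : A → A → Fˣ) (β : A → A → F)
    (hc : ∀ u v, b u * b v = (c u v : F) • b (u * v))
    (hβ : ∀ u v, b u * b v = β u v • (b v * b u)) (u v : A) :
    (c u v : F) = β u v * c v u := by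
  have h := hβ u v
  rw [hc, hc, smul_smul, mul_comm v] at h
  exact smul_left_injective F (b.ne_zero _) h

/-- Over an algebraically closed field, two twisted group algebras of an abelian group with the
same commutation factor are isomorphic as graded algebras. -/
theorem exists_algEquiv_of_twisted [IsAlgClosed F]
    (b : Module.Basis A F D) (b' : Module.Basis A F D') (β : A → A → F)
    (hb : ∀ u v, ∃ c : Fˣ, b u * b v = (c : F) • b (u * v))
    (hb' : ∀ u v, ∃ c : Fˣ, b' u * b' v = (c : F) • b' (u * v))
    (hβ : ∀ u v, b u * b v = β u v • (b v * b u))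
    (hβ' : ∀ u v, b' u * b' v = β u v • (b' v * b' u)) :
    ∃ (e : D ≃ₐ[F] D') (f : A → Fˣ), ∀ u, e (b u) = (f u : F) • b' u := by
  choose c hc using hb
  choose d hd using hb'
  obtain ⟨f, hf⟩ := exists_coboundary_of_symm_cocycle (IsAlgClosed.baer_units F)
    (fun u v => c u v / d u v)
    (fun u v => by
      have h₁ := twisted_comm b c β hc hβ u v
      have h₂ := twisted_comm b' d β hd hβ' u v
      rw [div_eq_div_iff_mul_eq_mul]
      refine Units.ext ?_
      push_cast
      rw [h₁, h₂]
      ring)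
    (fun u v w => by
      rw [div_mul_div_comm, div_mul_div_comm, twisted_cocycle b c hc, twisted_cocycle b' d hd])
  let ψ : D ≃ₗ[F] D' := b.equiv (b'.unitsSMul f) (Equiv.refl A)
  have hψ (u : A) : ψ (b u) = (f u : F) • b' u := by
    simp [ψ, Module.Basis.unitsSMul_apply, Units.smul_def]
  have hcf (u v : A) : (c u v : F) * f (u * v) = f u * f v * d u v := by
    have h := hf u v
    rw [div_mul_eq_mul_div, div_eq_iff_eq_mul] at h
    exact_mod_cast congrArg Units.val h
  have hmul : ∀ x y, ψ (x * y) = ψ x * ψ y := (LinearMap.map_mul_iff (ψ : D →ₗ[F] D')).2 <|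
    b.ext fun u => b.ext fun v => by
      simp [hc, hd, hψ, smul_smul, hcf, mul_comm, mul_left_comm]
  have hone : ψ 1 = 1 := by
    obtain ⟨x, hx⟩ := ψ.surjective 1
    have := hmul 1 x
    rwa [one_mul, hx, mul_one, eq_comm] at this
  exact ⟨AlgEquiv.ofLinearEquiv ψ hone hmul, f, hψ⟩

end TwistedGroupAlgebra

section Dinv

variable {F : Type u} [Field F] {G : Type v} [CommGroup G]

namespace IsDinv

variable [DecidableEq G] {D : Type w} [Ring D] [Algebra F D] {φ₀ : D →ₗ[F] D}
  {Dgr : G → Submodule F D} {X : G → D} {T : Subgroup G} {β : G → G → F} {τ : G → F}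

theorem linearIndependent (h : IsDinv F G D φ₀ Dgr X T β τ) :
    LinearIndependent F fun u : T => X u :=
  (h.1.submodule_iSupIndep.comp Subtype.val_injective).linearIndependent _
    (fun u : T => (h.2.2.2.2.2.2.1 u u.2).2.1) (fun u => (h.2.2.2.2.2.2.1 u u.2).1)

theorem span_eq_top (h : IsDinv F G D φ₀ Dgr X T β τ) :
    ⊤ ≤ Submodule.span F (Set.range fun u : T => X u) := by
  rw [← h.1.submodule_iSup_eq_top]
  refine iSup_le fun g x hx => ?_
  by_cases hg : g ∈ T
  · obtain ⟨c, rfl⟩ := (h.2.2.2.2.2.2.1 g hg).2.2 x hx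
    exact Submodule.smul_mem _ _ (Submodule.subset_span ⟨⟨g, hg⟩, rfl⟩)
  · rw [not_ne_iff.1 (mt (h.2.2.2.2.2.1 g).1 hg)] at hx
    rw [(Submodule.mem_bot F).1 hx]
    exact Submodule.zero_mem _

/-- The homogeneous basis `X` of `D_inv(T,β,τ)`. -/
noncomputable def basis (h : IsDinv F G D φ₀ Dgr X T β τ) : Module.Basis T F D :=
  Module.Basis.mk h.linearIndependent h.span_eq_top

theorem basis_apply (h : IsDinv F G D φ₀ Dgr X T β τ) (u : T) : h.basis u = X u :=
  Module.Basis.mk_apply _ _ u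

theorem basis_mul (h : IsDinv F G D φ₀ Dgr X T β τ) (u v : T) :
    ∃ c : Fˣ, h.basis u * h.basis v = (c : F) • h.basis (u * v) := by
  simp only [basis_apply]
  obtain ⟨hu, hu', -⟩ := h.2.2.2.2.2.2.1 u u.2
  obtain ⟨hv, hv', -⟩ := h.2.2.2.2.2.2.1 v v.2
  obtain ⟨c, hc⟩ := (h.2.2.2.2.2.2.1 _ (u * v).2).2.2 _ (h.2.2.1 u v _ hu' _ hv')
  have hc0 : c ≠ 0 := by
    rintro rfl
    rw [zero_smul, (h.2.2.2.2.1 u _ hu' hu).mul_right_eq_zero] at hc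
    exact hv hc
  exact ⟨Units.mk0 c hc0, hc⟩

theorem basis_comm (h : IsDinv F G D φ₀ Dgr X T β τ) (u v : T) :
    h.basis u * h.basis v = β u v • (h.basis v * h.basis u) := by
  simp only [basis_apply]
  exact h.2.2.2.2.2.2.2.1 u u.2 v v.2

theorem eq_zero_of_notMem (h : IsDinv F G D φ₀ Dgr X T β τ) {g : G} (hg : g ∉ T) {x : D}
    (hx : x ∈ Dgr g) : x = 0 := by
  rw [not_ne_iff.1 (mt (h.2.2.2.2.2.1 g).1 hg)] at hx
  exact (Submodule.mem_bot F).1 hx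

end IsDinv

theorem projT_of_mem {T' : Subgroup G} {t s : G} (h : s ∈ T') : projT G T' t s = s := by
  simp [projT, h]

theorem projT_of_notMem {T' : Subgroup G} {t s : G} (h : s ∉ T') : projT G T' t s = s * t := by
  simp [projT, h]

theorem tauExt_of_mem {T' : Subgroup G} {t s : G} {τ : G → F} (h : s ∈ T') :
    tauExt F G T' t τ s = τ s := by
  simp [tauExt, h]

theorem tauExt_of_notMem {T' : Subgroup G} {t s : G} {τ : G → F} (h : s ∉ T') :
    tauExt F G T' t τ s = -τ (s * t) := by
  simp [tauExt, h]

theorem mul_mem_iff_of_two_mul_card {T T' : Subgroup G} (hle : T' ≤ T) (hpos : Nat.card T ≠ 0)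
    (hidx : 2 * Nat.card T' = Nat.card T) {a b : G} (ha : a ∈ T) (hb : b ∈ T) :
    a * b ∈ T' ↔ (a ∈ T' ↔ b ∈ T') := by
  have h : (T'.subgroupOf T).index = 2 := by
    have h₁ := (T'.subgroupOf T).card_mul_index
    rw [Nat.card_congr (Subgroup.subgroupOfEquivOfLe hle).toEquiv, ← hidx, mul_comm 2] at h₁
    exact Nat.eq_of_mul_eq_mul_left (Nat.pos_of_ne_zero (by lia)) h₁
  simpa [Subgroup.mem_subgroupOf] using
    Subgroup.mul_mem_iff_of_index_two h (a := ⟨a, ha⟩) (b := ⟨b, hb⟩)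

/-- The projections along `t` between two index-2 subgroups not containing `t` are mutually
inverse. -/
noncomputable def projEquiv {t : G} (T₁ T₂ : Subgroup G) (htt : t * t = 1)
    (h₁ : ∀ u ∈ T₁, u * t ∉ T₁) (h₂ : ∀ u ∈ T₂, u * t ∉ T₂)
    (h₁₂ : ∀ u ∈ T₁, u ∉ T₂ → u * t ∈ T₂) (h₂₁ : ∀ u ∈ T₂, u ∉ T₁ → u * t ∈ T₁) :
    T₁ ≃ T₂ where
  toFun u := ⟨projT G T₂ t u, by
    by_cases h : (u : G) ∈ T₂
    · rwa [projT_of_mem h]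
    · rw [projT_of_notMem h]; exact h₁₂ u u.2 h⟩
  invFun u := ⟨projT G T₁ t u, by
    by_cases h : (u : G) ∈ T₁
    · rwa [projT_of_mem h]
    · rw [projT_of_notMem h]; exact h₂₁ u u.2 h⟩
  left_inv u := Subtype.ext <| by
    by_cases h : (u : G) ∈ T₂
    · simp [projT_of_mem h, projT_of_mem u.2]
    · simp [projT_of_notMem h, projT_of_notMem (h₁ u u.2), mul_assoc, htt]
  right_inv u := Subtype.ext <| by
    by_cases h : (u : G) ∈ T₁
    · simp [projT_of_mem h, projT_of_mem u.2]
    · simp [projT_of_notMem h, projT_of_notMem (h₂ u u.2), mul_assoc, htt]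

/-- If `ψ` sends each homogeneous element of `D` of degree `h` to an element of degree `h`
compatibly with the involutions, or of degree `h t` compatibly up to sign, then `ψ ⊕ ψ^op`
respects the gradings `Γ^ex_t`. -/
theorem exGrT_map_le {t : G} (htt : t * t = 1)
    {D D' : Type w} [Ring D] [Algebra F D] [Ring D'] [Algebra F D']
    {φ : D →ₗ[F] D} {φ' : D' →ₗ[F] D'} {Dgr : G → Submodule F D} {Dgr' : G → Submodule F D'}
    (ψ : D ≃ₐ[F] D')
    (hψ : ∀ h, ∀ x ∈ Dgr h, ∃ a ∈ Dgr' h, ∃ b ∈ Dgr' (h * t),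
      ψ x = a + b ∧ ψ (φ x) = φ' a - φ' b) (h : G) :
    ∀ z ∈ exGrT F G φ Dgr t h, ψ.prodCongr (AlgEquiv.op ψ) z ∈ exGrT F G φ' Dgr' t h := by
  rintro _ ⟨⟨x, y⟩, ⟨hx, hy⟩, rfl⟩
  obtain ⟨a, ha, b, hb, hab, hab'⟩ := hψ h x hx
  obtain ⟨a', ha', b', hb', hy, hy'⟩ := hψ (h * t) y hy
  rw [mul_assoc, htt, mul_one] at hb'
  refine ⟨(a + b', b + a'), ⟨add_mem ha hb', add_mem hb ha'⟩, ?_⟩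
  refine Prod.ext ?_ (MulOpposite.unop_injective ?_)
  · simp [hab, hy]
    abel
  · simp [hab', hy']
    abel

/-- A sufficient condition for `exGrT_map_le` on the spanning elements `X`. -/
theorem IsDinv.exists_decomp [DecidableEq G] {t : G} {D D' : Type w} [Ring D]
    [Algebra F D] [Ring D'] [Algebra F D'] {φ : D →ₗ[F] D} {φ' : D' →ₗ[F] D'}
    {Dgr : G → Submodule F D} {Dgr' : G → Submodule F D'} {X : G → D} {X' : G → D'}
    {T T' : Subgroup G} {β β' : G → G → F} {τ τ' : G → F}
    (hD : IsDinv F G D φ Dgr X T β τ) (hD' : IsDinv F G D' φ' Dgr' X' T' β' τ')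
    (hTT' : ∀ u ∈ T, projT G T' t u ∈ T')
    (hτ : ∀ s ∈ T, τ s = tauExt F G T' t τ' s)
    (ψ : D ≃ₐ[F] D') (hψ : ∀ u ∈ T, ψ (X u) ∈ Dgr' (projT G T' t u)) :
    ∀ h, ∀ x ∈ Dgr h, ∃ a ∈ Dgr' h, ∃ b ∈ Dgr' (h * t),
      ψ x = a + b ∧ ψ (φ x) = φ' a - φ' b := by
  intro h x hx
  by_cases hT : h ∈ T
  · have hφ : ∀ x ∈ Dgr h, φ x = τ h • x := hD.2.2.2.2.2.2.2.2.2.2 h hT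
    have hφ' : ∀ g ∈ T', ∀ x ∈ Dgr' g, φ' x = τ' g • x := hD'.2.2.2.2.2.2.2.2.2.2
    obtain ⟨c, rfl⟩ := (hD.2.2.2.2.2.2.1 h hT).2.2 x hx
    have hm : ψ (c • X h) ∈ Dgr' (projT G T' t h) := by
      rw [map_smul]
      exact Submodule.smul_mem _ _ (hψ h hT)
    have hT'' := hTT' h hT
    rw [hφ _ hx, map_smul ψ (τ h), hτ h hT]
    by_cases hT' : h ∈ T'
    · rw [projT_of_mem hT'] at hm
      exact ⟨_, hm, 0, zero_mem _, by simp, by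
        rw [hφ' _ hT' _ hm, tauExt_of_mem hT']; simp⟩
    · rw [projT_of_notMem hT'] at hm hT''
      exact ⟨0, zero_mem _, _, hm, by simp, by
        rw [hφ' _ hT'' _ hm, tauExt_of_notMem hT']; simp⟩
  · rw [hD.eq_zero_of_notMem hT hx]
    exact ⟨0, zero_mem _, 0, zero_mem _, by simp, by simp⟩

/-- The projection along `t` carries the polar form `β₁` to `β₂` when `τ₁^[t] = τ₂^[t]`. -/
theorem polar_projT {T₁ T₂ : Subgroup G} {t : G} {β₁ β₂ : G → G → F} {τ₁ τ₂ : G → F}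
    (htt : t * t = 1) (hq₁ : QuadData F G T₁ β₁ τ₁) (hq₂ : QuadData F G T₂ β₂ τ₂)
    (hmul : ∀ u ∈ T₁, ∀ v ∈ T₁, u * v ∈ T₂ ↔ (u ∈ T₂ ↔ v ∈ T₂))
    (hproj : ∀ u ∈ T₁, projT G T₂ t u ∈ T₂)
    (hτ : ∀ s ∈ T₁, τ₁ s = tauExt F G T₂ t τ₂ s) {u v : G} (hu : u ∈ T₁) (hv : v ∈ T₁) :
    β₁ u v = β₂ (projT G T₂ t u) (projT G T₂ t v) := by
  have huv := mul_mem hu hv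
  rw [hq₁.2.1 u hu v hv, hq₂.2.1 _ (hproj u hu) _ (hproj v hv), hτ u hu, hτ v hv, hτ _ huv]
  have hm := hmul u hu v hv
  by_cases h : u ∈ T₂ <;> by_cases h' : v ∈ T₂
  · have h'' : u * v ∈ T₂ := hm.2 (by simp [h, h'])
    simp only [projT_of_mem h, projT_of_mem h', tauExt_of_mem h, tauExt_of_mem h',
      tauExt_of_mem h'']
  · have h'' : u * v ∉ T₂ := fun k => by simp [h, h'] at hm; exact hm k
    simp only [projT_of_mem h, projT_of_notMem h', tauExt_of_mem h, tauExt_of_notMem h',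
      tauExt_of_notMem h'', mul_assoc u v t]
    ring
  · have h'' : u * v ∉ T₂ := fun k => by simp [h, h'] at hm; exact hm k
    simp only [projT_of_notMem h, projT_of_mem h', tauExt_of_notMem h, tauExt_of_mem h',
      tauExt_of_notMem h'', mul_right_comm u t v]
    ring
  · have h'' : u * v ∈ T₂ := hm.2 (by simp [h, h'])
    have e : u * t * (v * t) = u * v := by rw [mul_mul_mul_comm, htt, mul_one]
    simp only [projT_of_notMem h, projT_of_notMem h', tauExt_of_notMem h, tauExt_of_notMem h',
      tauExt_of_mem h'', e]
    ring

end Dinv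

/-!
STATEMENT 15.  Let T ≤ G be an elementary abelian 2-subgroup of rank 2m+1, t ∈ T of order 2,
and T₁, T₂ index-2 subgroups of T not containing t.  Let τ₁ : T₁ → F, τ₂ : T₂ → F be quadratic
forms whose polar forms β₁, β₂ are nondegenerate alternating bicharacters, with
τ₁^[t] = τ₂^[t].  Then D_inv(T₁,β₁,τ₁)^ex_t ≅ D_inv(T₂,β₂,τ₂)^ex_t as G-graded algebras with
involution (F algebraically closed, char F ≠ 2).
-/

theorem stmt_15
    (F : Type u) [Field F] [IsAlgClosed F] (hchar : ringChar F ≠ 2)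
    (G : Type v) [CommGroup G] [DecidableEq G]
    -- T elementary abelian 2-subgroup of rank 2m+1
    (T : Subgroup G) (hT2 : ∀ s ∈ T, s * s = 1)
    (m : ℕ) (hrank : Nat.card T = 2 ^ (2 * m + 1))
    -- t ∈ T of order 2
    (t : G) (ht : t ∈ T) (ht1 : t ≠ 1)
    -- T₁, T₂ index-2 subgroups of T not containing t
    (T₁ T₂ : Subgroup G) (hT₁ : T₁ ≤ T) (hT₂ : T₂ ≤ T)
    (hT₁idx : 2 * Nat.card T₁ = Nat.card T) (hT₂idx : 2 * Nat.card T₂ = Nat.card T)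
    (htT₁ : t ∉ T₁) (htT₂ : t ∉ T₂)
    -- the quadratic forms and their polar forms
    (β₁ β₂ : G → G → F) (τ₁ τ₂ : G → F)
    (hq₁ : QuadData F G T₁ β₁ τ₁) (hq₂ : QuadData F G T₂ β₂ τ₂)
    -- τ₁^[t] = τ₂^[t]
    (hτ : ∀ s ∈ T, tauExt F G T₁ t τ₁ s = tauExt F G T₂ t τ₂ s)
    -- D_inv(T₁,β₁,τ₁) and D_inv(T₂,β₂,τ₂)
    (D₁ : Type w) [Ring D₁] [Algebra F D₁] (φ₁ : D₁ →ₗ[F] D₁)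
    (Dgr₁ : G → Submodule F D₁) (X₁ : G → D₁)
    (hD₁ : IsDinv F G D₁ φ₁ Dgr₁ X₁ T₁ β₁ τ₁)
    (D₂ : Type w) [Ring D₂] [Algebra F D₂] (φ₂ : D₂ →ₗ[F] D₂)
    (Dgr₂ : G → Submodule F D₂) (X₂ : G → D₂)
    (hD₂ : IsDinv F G D₂ φ₂ Dgr₂ X₂ T₂ β₂ τ₂) :
    -- D_inv(T₁,β₁,τ₁)^ex_t ≅ D_inv(T₂,β₂,τ₂)^ex_t as G-graded algebras with involution
    ∃ e : (D₁ × D₁ᵐᵒᵖ) ≃ₐ[F] (D₂ × D₂ᵐᵒᵖ),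
      (∀ x : D₁ × D₁ᵐᵒᵖ, e (exInvG F D₁ x) = exInvG F D₂ (e x)) ∧
      (∀ h : G,
        Submodule.map (e : (D₁ × D₁ᵐᵒᵖ) →ₗ[F] (D₂ × D₂ᵐᵒᵖ)) (exGrT F G φ₁ Dgr₁ t h)
          = exGrT F G φ₂ Dgr₂ t h) := by
  have hpos : Nat.card T ≠ 0 := by rw [hrank]; positivity
  have htt := hT2 t ht
  have mem₁ {a b : G} (ha : a ∈ T) (hb : b ∈ T) :=
    mul_mem_iff_of_two_mul_card hT₁ hpos hT₁idx ha hb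
  have mem₂ {a b : G} (ha : a ∈ T) (hb : b ∈ T) :=
    mul_mem_iff_of_two_mul_card hT₂ hpos hT₂idx ha hb
  have ht₁ : ∀ u ∈ T, u * t ∈ T₁ ↔ u ∉ T₁ := fun u hu => by simp [mem₁ hu ht, htT₁]
  have ht₂ : ∀ u ∈ T, u * t ∈ T₂ ↔ u ∉ T₂ := fun u hu => by simp [mem₂ hu ht, htT₂]
  let π : T₁ ≃ T₂ := projEquiv T₁ T₂ htt
    (fun u hu h => (ht₁ u (hT₁ hu)).1 h hu) (fun u hu h => (ht₂ u (hT₂ hu)).1 h hu)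
    (fun u hu h => (ht₂ u (hT₁ hu)).2 h) (fun u hu h => (ht₁ u (hT₂ hu)).2 h)
  have hπ (u : T₁) : (π u : G) = projT G T₂ t u := rfl
  have hπ' (u : T₂) : (π.symm u : G) = projT G T₁ t u := rfl
  have hproj₂ : ∀ u ∈ T₁, projT G T₂ t u ∈ T₂ := fun u hu => (π ⟨u, hu⟩).2
  have hproj₁ : ∀ u ∈ T₂, projT G T₁ t u ∈ T₁ := fun u hu => (π.symm ⟨u, hu⟩).2
  have hτ₁ : ∀ s ∈ T₁, τ₁ s = tauExt F G T₂ t τ₂ s := fun s hs => by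
    rw [← hτ s (hT₁ hs), tauExt_of_mem hs]
  have hτ₂ : ∀ s ∈ T₂, τ₂ s = tauExt F G T₁ t τ₁ s := fun s hs => by
    rw [hτ s (hT₂ hs), tauExt_of_mem hs]
  have hπmul (u v : T₁) : π (u * v) = π u * π v := Subtype.ext <| by
    have hm := mem₂ (hT₁ u.2) (hT₁ v.2)
    push_cast
    simp only [hπ]
    push_cast
    by_cases h : (u : G) ∈ T₂ <;> by_cases h' : (v : G) ∈ T₂ <;> simp only [h, h'] at hm
    · rw [projT_of_mem h, projT_of_mem h', projT_of_mem (by simpa using hm)]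
    · rw [projT_of_mem h, projT_of_notMem h', projT_of_notMem (by simpa using hm), mul_assoc]
    · rw [projT_of_notMem h, projT_of_mem h', projT_of_notMem (by simpa using hm),
        mul_right_comm]
    · rw [projT_of_notMem h, projT_of_notMem h', projT_of_mem (by simpa using hm),
        mul_mul_mul_comm, htt, mul_one]
  have hβ (u v : T₁) : β₁ u v = β₂ (π u) (π v) :=
    polar_projT htt hq₁ hq₂ (fun u hu v hv => mem₂ (hT₁ hu) (hT₁ hv)) hproj₂ hτ₁ u.2 v.2
  obtain ⟨ψ, f, hψ⟩ := exists_algEquiv_of_twisted hD₁.basis (hD₂.basis.reindex π.symm)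
    (fun u v => β₁ u v) hD₁.basis_mul
    (fun u v => by simpa [hπmul] using hD₂.basis_mul (π u) (π v)) hD₁.basis_comm
    (fun u v => by simpa [hβ] using hD₂.basis_comm (π u) (π v))
  have hψX (u : T₁) : ψ (X₁ u) = (f u : F) • X₂ (π u) := by
    simpa [IsDinv.basis_apply] using hψ u
  have hle := exGrT_map_le htt ψ <| hD₁.exists_decomp hD₂ hproj₂ hτ₁ ψ fun u hu => by
    rw [hψX ⟨u, hu⟩]
    exact Submodule.smul_mem _ _ (hD₂.2.2.2.2.2.2.1 _ (hproj₂ u hu)).2.1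
  have hge := exGrT_map_le htt ψ.symm <|
    hD₂.exists_decomp hD₁ hproj₁ hτ₂ ψ.symm fun u hu => by
      have h := hψX (π.symm ⟨u, hu⟩)
      rw [π.apply_symm_apply, ← Units.smul_def, ← inv_smul_eq_iff, Units.smul_def,
        ← map_smul] at h
      rw [← h, ψ.symm_apply_apply]
      exact Submodule.smul_mem _ _ (hD₁.2.2.2.2.2.2.1 _ (hproj₁ u hu)).2.1
  refine ⟨ψ.prodCongr (AlgEquiv.op ψ), fun x => rfl, fun h => le_antisymm ?_ fun z hz => ?_⟩
  · rintro _ ⟨z, hz, rfl⟩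
    exact hle h z hz
  · exact ⟨_, hge h z hz, (ψ.prodCongr (AlgEquiv.op ψ)).apply_symm_apply z⟩
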